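/- For any finite-dimensional complex Hilbert space ℋ and every α ∈ (0,∞), the measured Rényi α-divergence (ρ,σ) ↦ D_α^meas(ρ‖σ) is lower semicontinuous on the set of pairs of nonzero positive semidefinite operators on ℋ. -/

import Mathlib

open Filter Set Topology
open scoped ComplexOrder

noncomputable section

namespace QRenyi

attribute [local instance] Classical.propDecidable

variable {ι : Type*} [Fintype ι] [DecidableEq ι]

/-- Apply a real function to the eigenvalues of a Hermitian matrix (functional calculus);
junk value `0` for non-Hermitian matrices. -/
noncomputable def hermApply (f : ℝ → ℝ) (A : Matrix ι ι ℂ) : Matrix ι ι ℂ :=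
  if hA : A.IsHermitian then hA.cfc f else 0

/-- Real power of a positive semidefinite matrix, taken on its support:
`t ↦ t ^ x` is applied to the nonzero eigenvalues and `0` is mapped to `0`.
In particular `matPow A 0` is the support projection of `A`. -/
noncomputable def matPow (A : Matrix ι ι ℂ) (x : ℝ) : Matrix ι ι ℂ :=
  hermApply (fun t => if t = 0 then 0 else t ^ x) A

/-- Logarithm of a positive semidefinite matrix taken on its support
(`Real.log 0 = 0` in Mathlib, matching the convention `log̃ 0 = 0`). -/
noncomputable def matLog (A : Matrix ι ι ℂ) : Matrix ι ι ℂ :=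
  hermApply Real.log A

/-- `supp ρ ≤ supp σ`, expressed (for PSD matrices) as inclusion of kernels. -/
def suppLE (ρ σ : Matrix ι ι ℂ) : Prop :=
  ∀ v : ι → ℂ, σ.mulVec v = 0 → ρ.mulVec v = 0

/-- The Loewner (positive semidefinite) order. -/
def loewnerLE (A B : Matrix ι ι ℂ) : Prop := (B - A).PosSemidef

/-- Real part of the trace. -/
noncomputable def reTrace (A : Matrix ι ι ℂ) : ℝ := A.trace.re

/-- The trace quantity `Tr ((σ^{(1-α)/(2z)} ρ^{α/z} σ^{(1-α)/(2z)})^z)` (a real number). -/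
noncomputable def Qaz (α z : ℝ) (ρ σ : Matrix ι ι ℂ) : ℝ :=
  reTrace (matPow (matPow σ ((1 - α) / (2 * z)) * matPow ρ (α / z) *
    matPow σ ((1 - α) / (2 * z))) z)

/-- The Rényi `(α,z)`-divergence (for `α ≠ 1`), with values in `EReal = ℝ ∪ {±∞}`.
It equals `(α-1)⁻¹ (log Q_{α,z}(ρ‖σ) - log Tr ρ)`; it is `+∞` when `α > 1` and
`supp ρ ≰ supp σ`, and also `+∞` when `α < 1` and `Q_{α,z}(ρ‖σ) = 0`
(i.e. `(α-1)⁻¹ log 0 = +∞`). -/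
noncomputable def Daz (α z : ℝ) (ρ σ : Matrix ι ι ℂ) : EReal :=
  if (suppLE ρ σ ∨ α < 1) ∧ Qaz α z ρ σ ≠ 0 then
    (((α - 1)⁻¹ * (Real.log (Qaz α z ρ σ) - Real.log (reTrace ρ)) : ℝ) : EReal)
  else ⊤

/-- The (normalized) Umegaki relative entropy. -/
noncomputable def DUm (ρ σ : Matrix ι ι ℂ) : EReal :=
  if suppLE ρ σ then
    (((reTrace ρ)⁻¹ * reTrace (ρ * (matLog ρ - matLog σ)) : ℝ) : EReal)
  else ⊤

/-- The Rényi `(α,z)`-divergence, with `D_{1,z} := D^Um`. -/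
noncomputable def Dfull (α z : ℝ) (ρ σ : Matrix ι ι ℂ) : EReal :=
  if α = 1 then DUm ρ σ else Daz α z ρ σ

/-- The max-relative entropy `D_max(ρ‖σ) = log inf {λ > 0 : ρ ≤ λ σ}`. -/
noncomputable def Dmax (ρ σ : Matrix ι ι ℂ) : EReal :=
  if ∃ c : ℝ, 0 < c ∧ loewnerLE ρ (c • σ) then
    ((Real.log (sInf {c : ℝ | 0 < c ∧ loewnerLE ρ (c • σ)}) : ℝ) : EReal)
  else ⊤

/-- The classical quantity `Q_α^cl(ρ‖σ) = ∑_x ρ(x)^α σ(x)^{1-α}` (with `0^t = 0` for `t ≠ 0`). -/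
noncomputable def Qcl {X : Type*} [Fintype X] (α : ℝ) (ρ σ : X → ℝ) : ℝ :=
  ∑ x, ρ x ^ α * σ x ^ (1 - α)

/-- Absolute continuity `ρ ≪ σ` for functions on a finite set. -/
def acl {X : Type*} (ρ σ : X → ℝ) : Prop := ∀ x, σ x = 0 → ρ x = 0

/-- The classical Rényi `α`-divergence, with values in `EReal`; for `α = 1` it is the
(normalized) Kullback-Leibler divergence. -/
noncomputable def Dcl {X : Type*} [Fintype X] (α : ℝ) (ρ σ : X → ℝ) : EReal :=
  if α = 1 then
    (if acl ρ σ then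
      ((((∑ x, ρ x)⁻¹ * ∑ x, ρ x * (Real.log (ρ x) - Real.log (σ x))) : ℝ) : EReal)
     else ⊤)
  else if (acl ρ σ ∨ α < 1) ∧ Qcl α ρ σ ≠ 0 then
    ((((α - 1)⁻¹ * (Real.log (Qcl α ρ σ) - Real.log (∑ x, ρ x))) : ℝ) : EReal)
  else ⊤

/-- The measured Rényi `α`-divergence: supremum over all finite-outcome POVMs. -/
noncomputable def Dmeas (α : ℝ) (ρ σ : Matrix ι ι ℂ) : EReal :=
  ⨆ (k : ℕ) (M : Fin k → Matrix ι ι ℂ)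
    (_ : (∀ i, (M i).PosSemidef) ∧ ∑ i, M i = 1),
    Dcl α (fun i => reTrace (M i * ρ)) (fun i => reTrace (M i * σ))

/-- A `κ`-function: a continuous nonnegative function on `[0,∞)` with
`limsup_{x→0⁺} f(x) x^{-κ} < ∞`. -/
def IsKappaFunction (κ : ℝ) (f : ℝ → ℝ) : Prop :=
  ContinuousOn f (Set.Ici 0) ∧ (∀ x ∈ Set.Ici (0 : ℝ), 0 ≤ f x) ∧
    ∃ M : ℝ, ∀ᶠ x in 𝓝[>] (0 : ℝ), f x ≤ M * x ^ κ

/-- A strict `κ`-function: a `κ`-function with `liminf_{x→0⁺} f(x) x^{-κ} > 0`. -/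
def IsStrictKappaFunction (κ : ℝ) (f : ℝ → ℝ) : Prop :=
  IsKappaFunction κ f ∧ ∃ c : ℝ, 0 < c ∧ ∀ᶠ x in 𝓝[>] (0 : ℝ), c * x ^ κ ≤ f x

/-- Nonzero PSD matrix predicate. -/
def PSDne (A : Matrix ι ι ℂ) : Prop := A.PosSemidef ∧ A ≠ 0


/-- The trace of a product of two positive semidefinite matrices is nonnegative. -/
lemma reTrace_mul_nonneg {κ : Type*} [Fintype κ] {A B : Matrix κ κ ℂ} (hA : A.PosSemidef) (hB : B.PosSemidef) :
    0 ≤ reTrace (A * B) := by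
  obtain ⟨m, v, hv⟩ := Matrix.posSemidef_iff_eq_sum_vecMulVec.mp hA
  rw [hv, Finset.sum_mul, reTrace, Matrix.trace_sum, Complex.re_sum]
  refine Finset.sum_nonneg fun i _ => ?_
  rw [Matrix.vecMulVec_mul, Matrix.trace_vecMulVec, dotProduct_comm, ← Matrix.dotProduct_mulVec]
  exact (Complex.le_def.mp (hB.dotProduct_mulVec_nonneg (v i))).1

lemma PSDne.reTrace_pos {κ : Type*} [Fintype κ] {A : Matrix κ κ ℂ} (hA : PSDne A) : 0 < reTrace A := by
  have h : 0 < A.trace :=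
    lt_of_le_of_ne hA.1.trace_nonneg fun h => hA.2 (hA.1.trace_eq_zero_iff.mp h.symm)
  exact (Complex.lt_def.mp h).1

lemma sum_reTrace_mul {κ : Type*} [Fintype κ] {M : κ → Matrix ι ι ℂ} (hM : ∑ i, M i = 1)
    (A : Matrix ι ι ℂ) : ∑ i, reTrace (M i * A) = reTrace A := by
  simp only [reTrace]
  rw [← Complex.re_sum, ← Matrix.trace_sum, ← Finset.sum_mul, hM, one_mul]

lemma continuous_reTrace_mul {κ : Type*} [Fintype κ] (A : Matrix κ κ ℂ) :
    Continuous fun B : Matrix κ κ ℂ => reTrace (A * B) :=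
  Complex.continuous_re.comp (continuous_const.matrix_mul continuous_id).matrix_trace

section Classical

variable {X : Type*} [Fintype X]

/-- The classical Rényi divergence of `ρ` and the shifted function `σ + ε`, as a real number. -/
def DclShift (α ε : ℝ) (ρ σ : X → ℝ) : ℝ :=
  if α = 1 then (∑ x, ρ x)⁻¹ * ∑ x, ρ x * (Real.log (ρ x) - Real.log (σ x + ε))
  else (α - 1)⁻¹ * (Real.log (Qcl α ρ fun x => σ x + ε) - Real.log (∑ x, ρ x))

/-- Pairs of nonnegative functions the first of which is nonzero. -/
def nonnegPairs (X : Type*) [Fintype X] : Set ((X → ℝ) × (X → ℝ)) :=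
  {p | (∀ x, 0 ≤ p.1 x) ∧ (∀ x, 0 ≤ p.2 x) ∧ 0 < ∑ x, p.1 x}

lemma exists_pos_of_mem_nonnegPairs {p : (X → ℝ) × (X → ℝ)} (hp : p ∈ nonnegPairs X) :
    ∃ x, 0 < p.1 x := by
  obtain ⟨x, -, hx⟩ := Finset.exists_lt_of_sum_lt (s := Finset.univ) (f := fun _ => (0 : ℝ))
    (g := p.1) (by simpa using hp.2.2)
  exact ⟨x, hx⟩

lemma Qcl_pos {α : ℝ} {ρ σ : X → ℝ} (hρ : ∀ x, 0 ≤ ρ x) (hσ : ∀ x, 0 ≤ σ x) {x : X}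
    (hρx : 0 < ρ x) (hσx : 0 < σ x) : 0 < Qcl α ρ σ :=
  Finset.sum_pos' (fun y _ => mul_nonneg (Real.rpow_nonneg (hρ y) _) (Real.rpow_nonneg (hσ y) _))
    ⟨x, Finset.mem_univ x, mul_pos (Real.rpow_pos_of_pos hρx _) (Real.rpow_pos_of_pos hσx _)⟩

lemma Qcl_shift_pos {α ε : ℝ} (hε : 0 < ε) {p : (X → ℝ) × (X → ℝ)} (hp : p ∈ nonnegPairs X) :
    0 < Qcl α p.1 fun x => p.2 x + ε := by
  obtain ⟨x, hx⟩ := exists_pos_of_mem_nonnegPairs hp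
  exact Qcl_pos hp.1 (fun y => (add_pos_of_nonneg_of_pos (hp.2.1 y) hε).le) hx
    (add_pos_of_nonneg_of_pos (hp.2.1 x) hε)

lemma continuousOn_DclShift {α ε : ℝ} (hα : 0 < α) (hε : 0 < ε) :
    ContinuousOn (fun p : (X → ℝ) × (X → ℝ) => DclShift α ε p.1 p.2) (nonnegPairs X) := by
  have hshift : ∀ x, ∀ p ∈ nonnegPairs X, p.2 x + ε ≠ 0 := fun x p hp =>
    (add_pos_of_nonneg_of_pos (hp.2.1 x) hε).ne'
  unfold DclShift
  split_ifs with h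
  · simp only [mul_sub]
    refine ContinuousOn.mul (ContinuousOn.inv₀ (by fun_prop) fun p hp => hp.2.2.ne')
      (continuousOn_finsetSum _ fun x _ => ContinuousOn.sub ?_ ?_)
    · exact (Real.continuous_mul_log.comp
        ((continuous_apply x).comp continuous_fst)).continuousOn
    · exact ContinuousOn.mul (by fun_prop) (ContinuousOn.log (by fun_prop) (hshift x))
  · refine ContinuousOn.mul continuousOn_const (ContinuousOn.sub
      (ContinuousOn.log ?_ fun p hp => (Qcl_shift_pos hε hp).ne')
      (ContinuousOn.log (by fun_prop) fun p hp => hp.2.2.ne'))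
    refine continuousOn_finsetSum _ fun x _ => ContinuousOn.mul ?_ ?_
    · exact ContinuousOn.rpow_const (by fun_prop) fun p _ => Or.inr hα.le
    · exact ContinuousOn.rpow_const (by fun_prop) fun p hp => Or.inl (hshift x p hp)

lemma DclShift_le_Dcl {α ε : ℝ} (hα : 0 < α) (hε : 0 < ε) {p : (X → ℝ) × (X → ℝ)}
    (hp : p ∈ nonnegPairs X) : (DclShift α ε p.1 p.2 : EReal) ≤ Dcl α p.1 p.2 := by
  obtain ⟨hρ, hσ, hsum⟩ := id hp
  unfold DclShift Dcl
  by_cases h : α = 1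
  · simp only [if_pos h]
    split_ifs with hac
    swap; · exact le_top
    refine EReal.coe_le_coe (mul_le_mul_of_nonneg_left
      (Finset.sum_le_sum fun x _ => ?_) (inv_nonneg.mpr hsum.le))
    rcases (hσ x).eq_or_lt' with h0 | h0
    · simp [hac x h0]
    · refine mul_le_mul_of_nonneg_left ?_ (hρ x)
      linarith [Real.log_le_log h0 (by linarith : p.2 x ≤ p.2 x + ε)]
  · simp only [if_neg h]
    split_ifs with hc
    swap; · exact le_top
    refine EReal.coe_le_coe ?_
    have hQ : 0 < Qcl α p.1 p.2 := lt_of_le_of_ne (Finset.sum_nonneg fun x _ =>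
      mul_nonneg (Real.rpow_nonneg (hρ x) _) (Real.rpow_nonneg (hσ x) _)) hc.2.symm
    rcases lt_or_gt_of_ne h with h1 | h1
    · refine mul_le_mul_of_nonpos_left (sub_le_sub_right (Real.log_le_log hQ ?_) _)
        (inv_nonpos.mpr (by linarith))
      refine Finset.sum_le_sum fun x _ => mul_le_mul_of_nonneg_left ?_ (Real.rpow_nonneg (hρ x) _)
      exact Real.rpow_le_rpow (hσ x) (by linarith) (by linarith)
    · refine mul_le_mul_of_nonneg_left
        (sub_le_sub_right (Real.log_le_log (Qcl_shift_pos hε hp) ?_) _)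
        (inv_nonneg.mpr (by linarith))
      refine Finset.sum_le_sum fun x _ => ?_
      have hac := hc.1.resolve_right h1.not_gt
      rcases (hσ x).eq_or_lt' with h0 | h0
      · simp [hac x h0, Real.zero_rpow hα.ne']
      · exact mul_le_mul_of_nonneg_left
          (Real.rpow_le_rpow_of_nonpos h0 (by linarith) (by linarith)) (Real.rpow_nonneg (hρ x) _)

lemma tendsto_const_add_nhdsGT_zero (s : ℝ) :
    Tendsto (fun ε : ℝ => s + ε) (𝓝[>] 0) (𝓝 s) := by
  have h : Tendsto (fun ε : ℝ => s + ε) (𝓝 0) (𝓝 (s + 0)) :=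
    (continuous_const_add s).tendsto 0
  rw [add_zero] at h
  exact h.mono_left nhdsWithin_le_nhds

lemma tendsto_Qcl_shift {α : ℝ} (hα : 0 < α) {ρ σ : X → ℝ} (h : acl ρ σ ∨ α < 1) :
    Tendsto (fun ε : ℝ => Qcl α ρ fun x => σ x + ε) (𝓝[>] 0) (𝓝 (Qcl α ρ σ)) := by
  refine tendsto_finsetSum _ fun x _ => ?_
  by_cases h0 : σ x = 0 ∧ ¬ α < 1
  · simp [(h.resolve_right h0.2) x h0.1, Real.zero_rpow hα.ne']
  · refine tendsto_const_nhds.mul ((tendsto_const_add_nhdsGT_zero (σ x)).rpow_const ?_)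
    by_cases hs : σ x = 0
    · have : α < 1 := by tauto
      exact Or.inr (by linarith)
    · exact Or.inl hs

/-- A finite sum of functions tends to infinity if one summand does and the others are
eventually bounded below. -/
lemma tendsto_sum_atTop {β : Type*} {l : Filter β} {f : X → β → ℝ} (x : X) {c : X → ℝ}
    (hx : Tendsto (f x) l atTop) (hc : ∀ᶠ b in l, ∀ y, c y ≤ f y b) :
    Tendsto (fun b => ∑ y, f y b) l atTop := by
  refine tendsto_atTop_mono' l ?_
    (tendsto_atTop_add_const_right l (∑ y ∈ Finset.univ.erase x, c y) hx)
  filter_upwards [hc] with b hb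
  rw [← Finset.add_sum_erase _ _ (Finset.mem_univ x)]
  gcongr with y
  exact hb y

lemma tendsto_DclShift {α : ℝ} (hα : 0 < α) {p : (X → ℝ) × (X → ℝ)} (hp : p ∈ nonnegPairs X) :
    Tendsto (fun ε : ℝ => (DclShift α ε p.1 p.2 : EReal)) (𝓝[>] 0) (𝓝 (Dcl α p.1 p.2)) := by
  obtain ⟨hρ, hσ, hsum⟩ := id hp
  unfold DclShift Dcl
  by_cases h : α = 1
  · simp only [if_pos h]
    split_ifs with hac
    · refine EReal.tendsto_coe.mpr (tendsto_const_nhds.mul (tendsto_finsetSum _ fun x _ => ?_))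
      by_cases h0 : p.2 x = 0
      · simp [hac x h0]
      · exact tendsto_const_nhds.mul
          (tendsto_const_nhds.sub ((tendsto_const_add_nhdsGT_zero (p.2 x)).log h0))
    · refine EReal.tendsto_coe_nhds_top_iff.mpr
        (Tendsto.const_mul_atTop (inv_pos.mpr hsum) ?_)
      simp only [acl, not_forall] at hac
      obtain ⟨x, hx0, hx⟩ := hac
      refine tendsto_sum_atTop x
        (c := fun y => p.1 y * (Real.log (p.1 y) - Real.log (p.2 y + 1))) ?_ ?_
      · refine Tendsto.const_mul_atTop (lt_of_le_of_ne (hρ x) (Ne.symm hx)) ?_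
        simp only [hx0, zero_add, sub_eq_add_neg]
        exact tendsto_atTop_add_const_left _ _
          (tendsto_neg_atBot_atTop.comp Real.tendsto_log_nhdsGT_zero)
      · filter_upwards [Ioo_mem_nhdsGT (zero_lt_one' ℝ)] with ε hε y
        refine mul_le_mul_of_nonneg_left (sub_le_sub_left (Real.log_le_log ?_ ?_) _) (hρ y)
        · linarith [hσ y, hε.1]
        · linarith [hε.2]
  · simp only [if_neg h]
    split_ifs with hc
    · exact EReal.tendsto_coe.mpr (tendsto_const_nhds.mul
        (((tendsto_Qcl_shift hα hc.1).log hc.2).sub tendsto_const_nhds))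
    · refine EReal.tendsto_coe_nhds_top_iff.mpr ?_
      have hpos : ∀ᶠ ε : ℝ in 𝓝[>] 0, 0 < Qcl α p.1 fun x => p.2 x + ε := by
        filter_upwards [self_mem_nhdsWithin] with ε hε using Qcl_shift_pos hε hp
      rcases lt_or_gt_of_ne h with h1 | h1
      · have hQ : Qcl α p.1 p.2 = 0 := by
          by_contra hQ
          exact hc ⟨Or.inr h1, hQ⟩
        have ht := tendsto_Qcl_shift hα (ρ := p.1) (σ := p.2) (Or.inr h1)
        rw [hQ] at ht
        exact (tendsto_atBot_add_const_right _ (-Real.log (∑ x, p.1 x))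
          (Real.tendsto_log_nhdsGT_zero.comp
            (tendsto_nhdsWithin_iff.mpr ⟨ht, hpos⟩))).const_mul_atBot_of_neg
            (inv_lt_zero.mpr (by linarith))
      · have hac : ¬ acl p.1 p.2 := fun hac => by
          obtain ⟨x, hx⟩ := exists_pos_of_mem_nonnegPairs hp
          refine hc ⟨Or.inl hac, (Qcl_pos hρ hσ hx ?_).ne'⟩
          exact lt_of_le_of_ne (hσ x) fun h0 => hx.ne' (hac x h0.symm)
        simp only [acl, not_forall] at hac
        obtain ⟨x, hx0, hx⟩ := hac
        refine Tendsto.const_mul_atTop (inv_pos.mpr (by linarith))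
          (tendsto_atTop_add_const_right _ (-Real.log (∑ x, p.1 x))
            (Real.tendsto_log_atTop.comp (tendsto_sum_atTop x (c := 0) ?_ ?_)))
        · simp only [hx0, zero_add]
          exact (tendsto_rpow_neg_nhdsGT_zero (by linarith)).const_mul_atTop
            (Real.rpow_pos_of_pos (lt_of_le_of_ne (hρ x) (Ne.symm hx)) _)
        · filter_upwards [self_mem_nhdsWithin] with ε hε y
          exact mul_nonneg (Real.rpow_nonneg (hρ y) _)
            (Real.rpow_nonneg (add_nonneg (hσ y) (le_of_lt hε)) _)

/-- The classical Rényi divergence is lower semicontinuous. -/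
lemma lowerSemicontinuousOn_Dcl {α : ℝ} (hα : 0 < α) :
    LowerSemicontinuousOn (fun p : (X → ℝ) × (X → ℝ) => Dcl α p.1 p.2) (nonnegPairs X) := by
  intro p hp y hy
  obtain ⟨ε, hyε, hε⟩ :=
    (((tendsto_DclShift hα hp).eventually_const_lt hy).and self_mem_nhdsWithin).exists
  have hcont := (continuous_coe_real_ereal.continuousAt.tendsto.comp
    (continuousOn_DclShift hα hε p hp)).eventually_const_lt hyε
  filter_upwards [hcont, self_mem_nhdsWithin] with q hq hqS
  exact hq.trans_le (DclShift_le_Dcl hα hε hqS)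

end Classical

/-- For every `α ∈ (0,∞)`, the measured Rényi `α`-divergence is
lower semicontinuous on pairs of nonzero PSD operators. -/
theorem measured_renyi_lowerSemicontinuousOn (n : ℕ) (α : ℝ) (hα : 0 < α) :
    LowerSemicontinuousOn
      (fun p : Matrix (Fin n) (Fin n) ℂ × Matrix (Fin n) (Fin n) ℂ => Dmeas α p.1 p.2)
      {p : Matrix (Fin n) (Fin n) ℂ × Matrix (Fin n) (Fin n) ℂ | PSDne p.1 ∧ PSDne p.2} := by
  refine lowerSemicontinuousOn_iSup fun k => lowerSemicontinuousOn_iSup fun M =>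
    lowerSemicontinuousOn_iSup fun hM => ?_
  refine (lowerSemicontinuousOn_Dcl hα).comp (g := fun p : Matrix (Fin n) (Fin n) ℂ ×
      Matrix (Fin n) (Fin n) ℂ =>
    (fun i => reTrace (M i * p.1), fun i => reTrace (M i * p.2))) (Continuous.continuousOn ?_) ?_
  · exact (continuous_pi fun i => (continuous_reTrace_mul (M i)).comp continuous_fst).prodMk
      (continuous_pi fun i => (continuous_reTrace_mul (M i)).comp continuous_snd)
  · rintro p ⟨hρ, hσ⟩
    refine ⟨fun i => reTrace_mul_nonneg (hM.1 i) hρ.1,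
      fun i => reTrace_mul_nonneg (hM.1 i) hσ.1, ?_⟩
    exact (sum_reTrace_mul hM.2 p.1).symm ▸ hρ.reTrace_pos

end QRenyi

end
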